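/- For any cograph G on n vertices and integer k, every connected component of the token jumping reconfiguration graph TJ_k(G) has diameter at most 2n − k. -/

import Mathlib

open Finset

variable {V : Type*}

/-- `I` is an independent set of `G`. -/
def IsIndep (G : SimpleGraph V) (I : Finset V) : Prop :=
  ∀ u ∈ I, ∀ v ∈ I, ¬ G.Adj u v

/-- One token addition or removal between independent sets of size at least `k`. -/
def TarStep [DecidableEq V] (G : SimpleGraph V) (k : ℕ) (I J : Finset V) : Prop :=
  IsIndep G I ∧ IsIndep G J ∧ k ≤ I.card ∧ k ≤ J.card ∧
    ∃ v : V, J = insert v I ∨ I = insert v J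

/-- TAR-reachability with token lower bound `k`. -/
def TarReach [DecidableEq V] (G : SimpleGraph V) (k : ℕ) (I J : Finset V) : Prop :=
  Relation.ReflTransGen (TarStep G k) I J

/-- TAR-reachability inside the subgraph of `G` induced by `S`. -/
def TarReachOn [DecidableEq V] (G : SimpleGraph V) (S : Finset V) (k : ℕ)
    (I J : Finset V) : Prop :=
  Relation.ReflTransGen (fun I J => I ⊆ S ∧ J ⊆ S ∧ TarStep G k I J) I J

/-- A `k`-TAR-sequence of length `n`: independent sets of size at least `k`,
consecutive sets differing by at most one token addition or removal. -/
def IsTarSeq [DecidableEq V] (G : SimpleGraph V) (k n : ℕ) (f : ℕ → Finset V) : Prop :=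
  (∀ i ≤ n, IsIndep G (f i) ∧ k ≤ (f i).card) ∧
  (∀ i < n, ∃ v : V, f (i + 1) = insert v (f i) ∨ f i = insert v (f (i + 1)))

/-- A TJ-sequence of length `n`: independent sets of constant size,
consecutive sets differing by one token jump. -/
def IsTJSeq [DecidableEq V] (G : SimpleGraph V) (n : ℕ) (f : ℕ → Finset V) : Prop :=
  (∀ i ≤ n, IsIndep G (f i)) ∧ (∀ i ≤ n, (f i).card = (f 0).card) ∧
  (∀ i < n, ∃ u v : V, u ∈ f i ∧ f (i + 1) = insert v ((f i).erase u))

/-- `G` is a cograph: it has no induced path on four vertices. -/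
def Cograph (G : SimpleGraph V) : Prop :=
  ¬ ∃ a b c d : V, a ≠ b ∧ a ≠ c ∧ a ≠ d ∧ b ≠ c ∧ b ≠ d ∧ c ≠ d ∧
    G.Adj a b ∧ G.Adj b c ∧ G.Adj c d ∧ ¬ G.Adj a c ∧ ¬ G.Adj a d ∧ ¬ G.Adj b d

section Decomposition

/-- `S` splits into two nonempty parts with no edges, or all edges, between them. -/
def Splits (G : SimpleGraph V) [DecidableEq V] (S : Finset V) : Prop :=
  ∃ P Q : Finset V, P ∪ Q = S ∧ Disjoint P Q ∧ P.Nonempty ∧ Q.Nonempty ∧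
    ((∀ p ∈ P, ∀ q ∈ Q, ¬ G.Adj p q) ∨ ∀ p ∈ P, ∀ q ∈ Q, G.Adj p q)

theorem Cograph.compl {G : SimpleGraph V} (hG : Cograph G) : Cograph Gᶜ := by
  rintro ⟨a, b, c, d, hab, hac, had, hbc, hbd, hcd, h1, h2, h3, h4, h5, h6⟩
  simp only [SimpleGraph.compl_adj] at h1 h2 h3 h4 h5 h6
  refine hG ⟨b, d, a, c, hbd, hab.symm, hbc, had.symm, hcd.symm, hac, ?_, ?_, ?_, ?_, ?_, ?_⟩
  · tauto
  · rw [G.adj_comm]; tauto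
  · tauto
  · rw [G.adj_comm]; tauto
  · tauto
  · rw [G.adj_comm]; tauto

variable [DecidableEq V]

theorem Splits.of_compl {G : SimpleGraph V} {S : Finset V} (h : Splits Gᶜ S) : Splits G S := by
  obtain ⟨P, Q, hS, hd, hP, hQ, h⟩ := h
  refine ⟨P, Q, hS, hd, hP, hQ, ?_⟩
  have hne : ∀ p ∈ P, ∀ q ∈ Q, p ≠ q := fun p hp q hq => Finset.disjoint_iff_ne.1 hd p hp q hq
  simp only [SimpleGraph.compl_adj] at h
  rcases h with h | h
  · exact Or.inr fun p hp q hq => by have := h p hp q hq; have := hne p hp q hq; tauto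
  · exact Or.inl fun p hp q hq => (h p hp q hq).2

/-- Adding a vertex to a set that splits without edges gives a set that splits. -/
theorem Cograph.splits_insert {G : SimpleGraph V} (hG : Cograph G) {P Q : Finset V} {x : V}
    (hx : x ∉ P ∪ Q) (hP : P.Nonempty) (hQ : Q.Nonempty) (hd : Disjoint P Q)
    (hPQ : ∀ p ∈ P, ∀ q ∈ Q, ¬ G.Adj p q) : Splits G (insert x (P ∪ Q)) := by
  classical
  have key : ∀ P Q : Finset V, x ∉ P ∪ Q → P.Nonempty → Q.Nonempty → Disjoint P Q →
      (∀ p ∈ P, ∀ q ∈ Q, ¬ G.Adj p q) → ∀ u ∈ P, ∀ v ∈ P, G.Adj x u → ¬ G.Adj x v → G.Adj u v →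
      Splits G (insert x (P ∪ Q)) := by
    intro P Q hx hP hQ hd hPQ u hu v hv hxu hxv huv
    simp only [Finset.mem_union, not_or] at hx
    have hne := Finset.disjoint_iff_ne.1 hd
    by_cases hz : ∃ z ∈ Q, G.Adj x z
    · obtain ⟨z, hzQ, hxz⟩ := hz
      exact absurd ⟨v, u, x, z, huv.ne', fun h => hx.1 (h ▸ hv), hne v hv z hzQ, hxu.ne',
        hne u hu z hzQ, hxz.ne, huv.symm, hxu.symm, hxz, fun h => hxv h.symm,
        hPQ v hv z hzQ, hPQ u hu z hzQ⟩ hG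
    · push Not at hz
      refine ⟨insert x P, Q, by simp, ?_, by simp, hQ, Or.inl ?_⟩
      · simp [hx.2, hd]
      · intro p hp q hq
        rcases Finset.mem_insert.1 hp with rfl | hp
        exacts [hz q hq, hPQ p hp q hq]
  by_cases hedge : ∃ u ∈ P ∪ Q, ∃ v ∈ P ∪ Q, G.Adj x u ∧ ¬ G.Adj x v ∧ G.Adj u v
  · obtain ⟨u, hu, v, hv, hxu, hxv, huv⟩ := hedge
    rcases Finset.mem_union.1 hu with hu | hu <;> rcases Finset.mem_union.1 hv with hv | hv
    · exact key P Q hx hP hQ hd hPQ u hu v hv hxu hxv huv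
    · exact absurd huv (hPQ u hu v hv)
    · exact absurd huv.symm (hPQ v hv u hu)
    · rw [Finset.union_comm] at hx ⊢
      exact key Q P hx hQ hP hd.symm (fun q hq p hp h => hPQ p hp q hq h.symm) u hu v hv hxu hxv huv
  push Not at hedge
  by_cases hall : ∀ v ∈ P ∪ Q, G.Adj x v
  · refine ⟨{x}, P ∪ Q, rfl, by simpa using hx, by simp, hP.mono Finset.subset_union_left,
      Or.inr ?_⟩
    simpa using hall
  push Not at hall
  obtain ⟨y, hy, hxy⟩ := hall
  refine ⟨(P ∪ Q).filter (¬ G.Adj x ·), insert x ((P ∪ Q).filter (G.Adj x ·)), ?_, ?_,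
    ⟨y, by simp only [Finset.mem_filter]; exact ⟨hy, hxy⟩⟩, by simp, Or.inl ?_⟩
  · ext a; simp only [Finset.mem_union, Finset.mem_insert, Finset.mem_filter]; tauto
  · rw [Finset.disjoint_left]
    intro a ha hb
    simp only [Finset.mem_insert, Finset.mem_filter] at ha hb
    rcases hb with rfl | hb
    exacts [hx ha.1, ha.2 hb.2]
  · intro p hp q hq hpq
    simp only [Finset.mem_insert, Finset.mem_filter] at hp hq
    rcases hq with rfl | hq
    exacts [hp.2 hpq.symm, hedge q hq.1 p hp.1 hq.2 hp.2 hpq.symm]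

theorem Cograph.splits {G : SimpleGraph V} (hG : Cograph G) (S : Finset V) (hS : 1 < S.card) :
    Splits G S := by
  induction S using Finset.induction_on with
  | empty => simp at hS
  | insert x S hx ih =>
    by_cases h1 : 1 < S.card
    · obtain ⟨P, Q, rfl, hd, hP, hQ, h | h⟩ := ih h1
      · exact hG.splits_insert hx hP hQ hd h
      · exact (hG.compl.splits_insert hx hP hQ hd fun p hp q hq h' =>
          ((G.compl_adj p q).1 h').2 (h p hp q hq)).of_compl
    · rw [Finset.card_insert_of_notMem hx] at hS
      obtain ⟨y, rfl⟩ := Finset.card_eq_one.1 (by omega : S.card = 1)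
      refine ⟨{x}, {y}, rfl, by simpa using hx, by simp, by simp, ?_⟩
      by_cases h : G.Adj x y <;> simp [h]

end Decomposition

theorem IsIndep.subset {G : SimpleGraph V} {I J : Finset V} (hJ : IsIndep G J) (h : I ⊆ J) :
    IsIndep G I :=
  fun u hu v hv => hJ u (h hu) v (h hv)

theorem IsIndep.union [DecidableEq V] {G : SimpleGraph V} {I J : Finset V} (hI : IsIndep G I)
    (hJ : IsIndep G J) (h : ∀ u ∈ I, ∀ v ∈ J, ¬ G.Adj u v) : IsIndep G (I ∪ J) := by
  intro u hu v hv
  rcases Finset.mem_union.1 hu with hu | hu <;> rcases Finset.mem_union.1 hv with hv | hv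
  exacts [hI u hu v hv, h u hu v hv, fun e => h v hv u hu e.symm, hJ u hu v hv]

section OneInterval

variable [DecidableEq V] {G : SimpleGraph V} {S : Finset V} {t : ℕ}

/-- A token addition or removal on a pair (current set, discarded vertices): a removed vertex
is discarded, and discarded vertices are never added again. -/
def OnceStep (G : SimpleGraph V) (S : Finset V) (t : ℕ) (p q : Finset V × Finset V) : Prop :=
  (∃ v ∈ S, v ∉ p.1 ∧ v ∉ p.2 ∧ IsIndep G (insert v p.1) ∧ q = (insert v p.1, p.2)) ∨
  (∃ v ∈ p.1, t ≤ (p.1.erase v).card ∧ q = (p.1.erase v, insert v p.2))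

/-- Reachability by steps that add every vertex at most once. -/
abbrev OnceReach (G : SimpleGraph V) (S : Finset V) (t : ℕ) :
    Finset V × Finset V → Finset V × Finset V → Prop :=
  Relation.ReflTransGen (OnceStep G S t)

/-- A legal pair of a current independent set and a set of discarded vertices. -/
structure OnceState (G : SimpleGraph V) (S : Finset V) (p : Finset V × Finset V) : Prop where
  subset : p.1 ⊆ S
  discarded_subset : p.2 ⊆ S
  disjoint : Disjoint p.1 p.2
  indep : IsIndep G p.1

theorem OnceState.step {p q : Finset V × Finset V} (hp : OnceState G S p)
    (h : OnceStep G S t p q) : OnceState G S q := by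
  obtain ⟨h1, h2, h3, h4⟩ := hp
  rcases h with ⟨v, hvS, hv1, hv2, hi, rfl⟩ | ⟨v, hv, -, rfl⟩
  · exact ⟨Finset.insert_subset hvS h1, h2, by simp [hv2, h3], hi⟩
  · refine ⟨(Finset.erase_subset _ _).trans h1, Finset.insert_subset (h1 hv) h2, ?_,
      h4.subset (Finset.erase_subset _ _)⟩
    simp only [Finset.disjoint_insert_right, Finset.mem_erase, ne_eq, not_true_eq_false, false_and,
      not_false_eq_true, true_and]
    exact h3.mono_left (Finset.erase_subset _ _)

theorem OnceState.reach {p q : Finset V × Finset V} (hp : OnceState G S p)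
    (h : OnceReach G S t p q) : OnceState G S q := by
  induction h with
  | refl => exact hp
  | tail _ h ih => exact ih.step h

theorem OnceReach.tarReachOn {p q : Finset V × Finset V} (hp : OnceState G S p)
    (ht : t ≤ p.1.card) (h : OnceReach G S t p q) :
    TarReachOn G S t p.1 q.1 ∧ t ≤ q.1.card := by
  induction h with
  | refl => exact ⟨.refl, ht⟩
  | @tail q r hpq h ih =>
    have hq := hp.reach hpq
    have hr := hq.step h
    have hadj : t ≤ r.1.card ∧ ∃ v : V, r.1 = insert v q.1 ∨ q.1 = insert v r.1 := by
      rcases h with ⟨v, -, -, -, -, rfl⟩ | ⟨v, hv, hc, rfl⟩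
      · exact ⟨ih.2.trans (Finset.card_le_card (Finset.subset_insert _ _)), v, .inl rfl⟩
      · exact ⟨hc, v, .inr (Finset.insert_erase hv).symm⟩
    exact ⟨ih.1.tail ⟨hq.subset, hr.subset, hq.indep, hr.indep, ih.2, hadj.1, hadj.2⟩, hadj.1⟩

theorem OnceReach.mono {S' : Finset V} {p q : Finset V × Finset V} (hS : S ⊆ S')
    (h : OnceReach G S t p q) : OnceReach G S' t p q :=
  Relation.ReflTransGen.mono (fun _ _ h => h.imp (fun ⟨v, hv, h⟩ => ⟨v, hS hv, h⟩) id) _ _ h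

/-- A schedule on `P` can be run next to a fixed state on `Q`. -/
theorem OnceReach.union_right {P Q : Finset V} {i : ℕ} {p q y : Finset V × Finset V}
    (hd : Disjoint P Q) (hPQ : ∀ u ∈ P, ∀ v ∈ Q, ¬ G.Adj u v) (hp : OnceState G P p)
    (hy : OnceState G Q y) (ht : t ≤ i + y.1.card) (h : OnceReach G P i p q) :
    OnceReach G (P ∪ Q) t (p.1 ∪ y.1, p.2 ∪ y.2) (q.1 ∪ y.1, q.2 ∪ y.2) := by
  induction h with
  | refl => exact .refl
  | @tail q r hpq h ih =>
    have hq := hp.reach hpq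
    have hr := hq.step h
    refine ih.tail ?_
    rcases h with ⟨v, hvS, hv1, hv2, hi, rfl⟩ | ⟨v, hv, hc, rfl⟩
    · have hvQ : v ∉ Q := Finset.disjoint_left.1 hd hvS
      refine .inl ⟨v, Finset.mem_union_left _ hvS, ?_, ?_, ?_, ?_⟩
      · simpa [hv1] using fun h => hvQ (hy.subset h)
      · simpa [hv2] using fun h => hvQ (hy.discarded_subset h)
      · have := hr.indep.union hy.indep fun u hu v hv => hPQ u (hr.subset hu) v (hy.subset hv)
        rwa [Finset.insert_union] at this
      · simp [Finset.insert_union]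
    · have hvy : v ∉ y.1 := fun h => Finset.disjoint_left.1 hd (hq.subset hv) (hy.subset h)
      have he : (q.1 ∪ y.1).erase v = q.1.erase v ∪ y.1 := by
        rw [Finset.erase_union_distrib, Finset.erase_eq_of_notMem hvy]
      refine .inr ⟨v, Finset.mem_union_left _ hv, ?_, ?_⟩
      · have hdd : Disjoint (q.1.erase v) y.1 := Finset.disjoint_of_subset_left
          ((Finset.erase_subset _ _).trans hq.subset) (hd.mono_right hy.subset)
        simp only [he, Finset.card_union_of_disjoint hdd]
        omega
      · simp [he, Finset.insert_union]

/-- Fresh vertices can be added one at a time. -/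
theorem OnceReach.add {X D : Finset V} (Y : Finset V) (hY : Y ⊆ S) (hD : Disjoint Y D)
    (hi : IsIndep G (X ∪ Y)) : OnceReach G S t (X, D) (X ∪ Y, D) := by
  induction Y using Finset.induction_on with
  | empty => simpa using Relation.ReflTransGen.refl
  | insert v Y hv ih =>
    rw [Finset.insert_subset_iff] at hY
    rw [Finset.disjoint_insert_left] at hD
    rw [Finset.union_insert] at hi ⊢
    have h := ih hY.2 hD.2 (hi.subset (Finset.subset_insert _ _))
    by_cases hvX : v ∈ X ∪ Y
    · rwa [Finset.insert_eq_of_mem hvX]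
    · exact h.tail (.inl ⟨v, hY.1, hvX, hD.1, hi, rfl⟩)

/-- With threshold zero, all tokens can be removed. -/
theorem OnceReach.clear (X D : Finset V) : OnceReach G S 0 (X, D) (∅, D ∪ X) := by
  induction X using Finset.induction_on generalizing D with
  | empty => simpa using Relation.ReflTransGen.refl
  | insert v X hv ih =>
    refine .head (.inr ⟨v, Finset.mem_insert_self _ _, Nat.zero_le _, rfl⟩) ?_
    simp only [Finset.erase_insert hv]
    simpa [Finset.insert_union, Finset.union_insert] using ih (insert v D)

end OneInterval

section Schedule

variable [DecidableEq V]

theorem TarReachOn.anti {G : SimpleGraph V} {S I J : Finset V} {s t : ℕ} (hst : s ≤ t)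
    (h : TarReachOn G S t I J) : TarReachOn G S s I J :=
  Relation.ReflTransGen.mono (fun _ _ ⟨h1, h2, h3, h4, h5, h6, h7⟩ =>
    ⟨h1, h2, h3, h4, hst.trans h5, hst.trans h6, h7⟩) _ _ h

theorem TarReachOn.symm {G : SimpleGraph V} {S I J : Finset V} {t : ℕ}
    (h : TarReachOn G S t I J) : TarReachOn G S t J I :=
  haveI : Std.Symm fun I J => I ⊆ S ∧ J ⊆ S ∧ TarStep G t I J :=
    ⟨fun _ _ ⟨h1, h2, h3, h4, h5, h6, v, h7⟩ => ⟨h2, h1, h4, h3, h6, h5, v, h7.symm⟩⟩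
  Relation.ReflTransGen.stdSymm.symm _ _ h

/-- Lowering the threshold step by step, `C t` is a heaviest independent set reachable from `A`
with threshold `t`, and all of this is done while adding each vertex at most once. -/
structure Schedule (G : SimpleGraph V) (c : V → ℕ) (S A : Finset V) (C D : ℕ → Finset V) :
    Prop where
  eq_start : ∀ t, A.card < t → C t = A ∧ D t = ∅
  reach : ∀ t, OnceReach G S t (C (t + 1), D (t + 1)) (C t, D t)
  max : ∀ t ≤ A.card, ∀ X, TarReachOn G S t A X → ∑ v ∈ X, c v ≤ ∑ v ∈ C t, c v

/-- Weights for which larger sets are heavier. -/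
def CardMono (c : V → ℕ) : Prop :=
  ∀ X Y : Finset V, X.card < Y.card → ∑ v ∈ X, c v < ∑ v ∈ Y, c v

namespace Schedule

variable {G : SimpleGraph V} {c : V → ℕ} {S A : Finset V} {C D : ℕ → Finset V}

theorem state (h : Schedule G c S A C D) (hS : A ⊆ S) (hA : IsIndep G A) (t : ℕ) :
    OnceState G S (C t, D t) := by
  have hinit : ∀ s, A.card < s → OnceState G S (C s, D s) := by
    intro s hs
    obtain ⟨h1, h2⟩ := h.eq_start s hs
    rw [h1, h2]
    exact ⟨hS, by simp, by simp, hA⟩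
  have key : ∀ d s, A.card < s + d → OnceState G S (C s, D s) := by
    intro d
    induction d with
    | zero => exact hinit
    | succ d ih => exact fun s hs => (ih (s + 1) (by omega)).reach (h.reach s)
  exact key (A.card + 1) t (by omega)

theorem tarReachOn_succ (h : Schedule G c S A C D) (hS : A ⊆ S) (hA : IsIndep G A) {t : ℕ}
    (ht : t ≤ A.card) :
    TarReachOn G S t A (C (t + 1)) ∧ t ≤ (C (t + 1)).card := by
  have key : ∀ d s, s ≤ A.card → A.card ≤ s + d →
      TarReachOn G S s A (C (s + 1)) ∧ s ≤ (C (s + 1)).card := by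
    intro d
    induction d with
    | zero =>
      intro s hs hd
      rw [(h.eq_start (s + 1) (by omega)).1]
      exact ⟨.refl, hs⟩
    | succ d ih =>
      intro s hs hd
      rcases hs.eq_or_lt with rfl | hs'
      · rw [(h.eq_start (A.card + 1) (by omega)).1]
        exact ⟨.refl, hs⟩
      obtain ⟨h1, h2⟩ := ih (s + 1) (by omega) (by omega)
      obtain ⟨h3, h4⟩ := OnceReach.tarReachOn (h.state hS hA _) h2 (h.reach (s + 1))
      exact ⟨TarReachOn.anti (by omega) (h1.trans h3), by simp only at h4; omega⟩
  exact key A.card t ht (by omega)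

theorem tarReachOn (h : Schedule G c S A C D) (hS : A ⊆ S) (hA : IsIndep G A) {t : ℕ}
    (ht : t ≤ A.card) : TarReachOn G S t A (C t) := by
  obtain ⟨h1, h2⟩ := h.tarReachOn_succ hS hA ht
  exact h1.trans (OnceReach.tarReachOn (h.state hS hA _) h2 (h.reach t)).1

theorem card_le_of_tarReachOn (h : Schedule G c S A C D) (hc : CardMono c) {t : ℕ}
    (ht : t ≤ A.card) {X : Finset V} (hX : TarReachOn G S t A X) : X.card ≤ (C t).card := by
  by_contra! hlt
  exact (h.max t ht X hX).not_gt (hc _ _ hlt)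

theorem card_le (h : Schedule G c S A C D) (hc : CardMono c) (t : ℕ) :
    A.card ≤ (C t).card := by
  rcases le_or_gt t A.card with ht | ht
  · exact h.card_le_of_tarReachOn hc ht .refl
  · rw [(h.eq_start t ht).1]

theorem card_succ_le (h : Schedule G c S A C D) (hc : CardMono c) (hS : A ⊆ S)
    (hA : IsIndep G A) (t : ℕ) : (C (t + 1)).card ≤ (C t).card := by
  rcases le_or_gt t A.card with ht | ht
  · exact h.card_le_of_tarReachOn hc ht (h.tarReachOn_succ hS hA ht).1
  · rw [(h.eq_start t ht).1, (h.eq_start (t + 1) (by omega)).1]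

end Schedule

theorem exists_schedule_of_isIndep {G : SimpleGraph V} {c : V → ℕ} {S A : Finset V}
    (hS : IsIndep G S) (hAS : A ⊆ S) : ∃ C D, Schedule G c S A C D := by
  refine ⟨fun t => if A.card < t then A else S, fun _ => ∅, fun t ht => by simp [ht], ?_, ?_⟩
  · intro t
    by_cases h1 : A.card < t
    · simp only [h1, h1.trans t.lt_succ_self, if_true]; exact .refl
    by_cases h2 : A.card < t + 1
    · simp only [h1, h2, if_true, if_false]
      have h := OnceReach.add (G := G) (S := S) (t := t) (X := A) (D := ∅) S subset_rfl
        (by simp) (by rwa [Finset.union_eq_right.2 hAS])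
      rwa [Finset.union_eq_right.2 hAS] at h
    · simp only [h1, h2, if_false]; exact .refl
  · intro t ht X hX
    simp only [ht.not_gt, if_false]
    refine Finset.sum_le_sum_of_subset ?_
    rcases Relation.ReflTransGen.cases_tail hX with rfl | ⟨_, _, h⟩
    exacts [hAS, h.2.1]

/-- Constructs a sequence by downward recursion below an index `T`. -/
theorem exists_seq_of_downward_step {α : Type*} (T : ℕ) (f : ℕ → α) (P : ℕ → α → Prop)
    (R : ℕ → α → α → Prop) (hP : ∀ t, T ≤ t → P t (f t)) (hR : ∀ t, T ≤ t → R t (f (t + 1)) (f t))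
    (hs : ∀ t < T, ∀ a, P (t + 1) a → ∃ b, P t b ∧ R t a b) :
    ∃ g : ℕ → α, (∀ t, T ≤ t → g t = f t) ∧ (∀ t, P t (g t)) ∧ ∀ t, R t (g (t + 1)) (g t) := by
  induction T generalizing f with
  | zero => exact ⟨f, fun _ _ => rfl, fun t => hP t t.zero_le, fun t => hR t t.zero_le⟩
  | succ T ih =>
    obtain ⟨b, hb, hb'⟩ := hs T T.lt_succ_self _ (hP (T + 1) le_rfl)
    have hP' : ∀ t, T ≤ t → P t (Function.update f T b t) := by
      intro t ht
      rcases ht.eq_or_lt with rfl | ht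
      · simpa using hb
      · rw [Function.update_of_ne (by omega)]; exact hP t ht
    have hR' : ∀ t, T ≤ t → R t (Function.update f T b (t + 1)) (Function.update f T b t) := by
      intro t ht
      rw [Function.update_of_ne (by omega : t + 1 ≠ T)]
      rcases ht.eq_or_lt with rfl | ht
      · simpa using hb'
      · rw [Function.update_of_ne (by omega)]; exact hR t ht
    obtain ⟨g, h1, h2, h3⟩ := ih _ hP' hR' fun t ht => hs t (by omega)
    refine ⟨g, fun t ht => ?_, h2, h3⟩
    rw [h1 t (by omega), Function.update_of_ne (by omega)]

section Union

variable {G : SimpleGraph V} {c : V → ℕ} {P Q A B : Finset V} {C D E F : ℕ → Finset V}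

/-- Two schedules run next to each other until neither threshold can be lowered. -/
theorem Schedule.exists_stable (hc : CardMono c) (hd : Disjoint P Q)
    (hPQ : ∀ u ∈ P, ∀ v ∈ Q, ¬ G.Adj u v) (hAP : A ⊆ P) (hBQ : B ⊆ Q) (hA : IsIndep G A)
    (hB : IsIndep G B) (hP : Schedule G c P A C D) (hQ : Schedule G c Q B E F) (t n i j : ℕ)
    (hn : i + j ≤ n) (hi : t ≤ i + (E j).card) (hj : t ≤ j + (C i).card) :
    ∃ i' j', i' = t - (E j').card ∧ j' = t - (C i').card ∧
      OnceReach G (P ∪ Q) t (C i ∪ E j, D i ∪ F j) (C i' ∪ E j', D i' ∪ F j') := by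
  induction n generalizing i j with
  | zero => exact ⟨i, j, by omega, by omega, .refl⟩
  | succ n ih =>
    by_cases h1 : t - (E j).card < i
    · obtain ⟨i, rfl⟩ : ∃ m, i = m + 1 := ⟨i - 1, by omega⟩
      have hm := hP.card_succ_le hc hAP hA i
      obtain ⟨i', j', h2, h3, h4⟩ := ih i j (by omega) (by omega) (by omega)
      exact ⟨i', j', h2, h3, (OnceReach.union_right hd hPQ (hP.state hAP hA _)
        (hQ.state hBQ hB j) (by simp only; omega) (hP.reach i)).trans h4⟩
    by_cases h1' : t - (C i).card < j
    · obtain ⟨j, rfl⟩ : ∃ m, j = m + 1 := ⟨j - 1, by omega⟩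
      have hm := hQ.card_succ_le hc hBQ hB j
      obtain ⟨i', j', h2, h3, h4⟩ := ih i j (by omega) (by omega) (by omega)
      have h5 := OnceReach.union_right (t := t) hd.symm
        (fun v hv u hu h => hPQ u hu v hv h.symm) (hQ.state hBQ hB _)
        (hP.state hAP hA i) (by simp only; omega) (hQ.reach j)
      refine ⟨i', j', h2, h3, Relation.ReflTransGen.trans ?_ h4⟩
      simpa only [Finset.union_comm] using h5
    · exact ⟨i, j, by omega, by omega, .refl⟩

/-- Reachability in a disjoint union projects to the parts if sizes on the parts are bounded. -/
theorem tarReachOn_inter_of_union (hd : Disjoint P Q) {X : Finset V} {t m n : ℕ}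
    (hm : ∀ Y, TarReachOn G P (t - n) (A ∩ P) Y → Y.card ≤ m)
    (hn : ∀ Y, TarReachOn G Q (t - m) (A ∩ Q) Y → Y.card ≤ n)
    (h : TarReachOn G (P ∪ Q) t A X) :
    TarReachOn G P (t - n) (A ∩ P) (X ∩ P) ∧ TarReachOn G Q (t - m) (A ∩ Q) (X ∩ Q) := by
  induction h with
  | refl => exact ⟨.refl, .refl⟩
  | @tail X Y hX h ih =>
    obtain ⟨ihP, ihQ⟩ := ih
    obtain ⟨hXS, hYS, hXi, hYi, hXt, hYt, v, hv⟩ := h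
    have hXm := hm _ ihP
    have hXn := hn _ ihQ
    have hcard : ∀ Z ⊆ P ∪ Q, Z.card = (Z ∩ P).card + (Z ∩ Q).card := by
      intro Z hZ
      rw [← Finset.card_union_of_disjoint, ← Finset.inter_union_distrib_left,
        Finset.inter_eq_left.2 hZ]
      exact hd.mono Finset.inter_subset_right Finset.inter_subset_right
    have cX := hcard X hXS
    have cY := hcard Y hYS
    have hvS : v ∈ P ∪ Q := by
      rcases hv with rfl | rfl
      exacts [hYS (Finset.mem_insert_self _ _), hXS (Finset.mem_insert_self _ _)]
    have side : ∀ R T : Finset V, v ∈ R → v ∉ T →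
        (Y ∩ R = insert v (X ∩ R) ∨ X ∩ R = insert v (Y ∩ R)) ∧ X ∩ T = Y ∩ T := by
      intro R T hR hT
      rcases hv with rfl | rfl
      · rw [Finset.insert_inter_of_mem hR, Finset.insert_inter_of_notMem hT]
        exact ⟨.inl rfl, rfl⟩
      · rw [Finset.insert_inter_of_mem hR, Finset.insert_inter_of_notMem hT]
        exact ⟨.inr rfl, rfl⟩
    rcases Finset.mem_union.1 hvS with hvP | hvQ
    · obtain ⟨h1, h2⟩ := side P Q hvP (Finset.disjoint_left.1 hd hvP)
      refine ⟨ihP.tail ⟨Finset.inter_subset_right, Finset.inter_subset_right,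
        hXi.subset Finset.inter_subset_left, hYi.subset Finset.inter_subset_left, ?_, ?_, v, h1⟩,
        h2 ▸ ihQ⟩
      · omega
      · rw [← h2] at cY; omega
    · obtain ⟨h1, h2⟩ := side Q P hvQ (Finset.disjoint_right.1 hd hvQ)
      refine ⟨h2 ▸ ihP, ihQ.tail ⟨Finset.inter_subset_right, Finset.inter_subset_right,
        hXi.subset Finset.inter_subset_left, hYi.subset Finset.inter_subset_left, ?_, ?_, v, h1⟩⟩
      · omega
      · rw [← h2] at cY; omega

theorem exists_schedule_union (hc : CardMono c) (hd : Disjoint P Q)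
    (hPQ : ∀ u ∈ P, ∀ v ∈ Q, ¬ G.Adj u v) (hAPQ : A ⊆ P ∪ Q) (hA : IsIndep G A)
    (hP : Schedule G c P (A ∩ P) C D) (hQ : Schedule G c Q (A ∩ Q) E F) :
    ∃ C' D', Schedule G c (P ∪ Q) A C' D' := by
  have hsplit : A ∩ P ∪ A ∩ Q = A := by
    rw [← Finset.inter_union_distrib_left, Finset.inter_eq_left.2 hAPQ]
  have hcard : A.card = (A ∩ P).card + (A ∩ Q).card := by
    rw [← Finset.card_union_of_disjoint, hsplit]
    exact hd.mono Finset.inter_subset_right Finset.inter_subset_right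
  have hsP : A ∩ P ⊆ P := Finset.inter_subset_right
  have hsQ : A ∩ Q ⊆ Q := Finset.inter_subset_right
  have hiP : IsIndep G (A ∩ P) := hA.subset Finset.inter_subset_left
  have hiQ : IsIndep G (A ∩ Q) := hA.subset Finset.inter_subset_left
  obtain ⟨g, hg0, hg, hgr⟩ := exists_seq_of_downward_step (A.card + 1)
    (fun t => (t - (A ∩ Q).card, t - (A ∩ P).card))
    (fun t ij => ij.1 = t - (E ij.2).card ∧ ij.2 = t - (C ij.1).card)
    (fun t a b => OnceReach G (P ∪ Q) t (C a.1 ∪ E a.2, D a.1 ∪ F a.2)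
      (C b.1 ∪ E b.2, D b.1 ∪ F b.2))
    (by
      intro t ht
      simp only [(hP.eq_start (t - (A ∩ Q).card) (by omega)).1,
        (hQ.eq_start (t - (A ∩ P).card) (by omega)).1, and_self])
    (by
      intro t ht
      obtain ⟨h1, h2⟩ := hP.eq_start (t - (A ∩ Q).card) (by omega)
      obtain ⟨h3, h4⟩ := hQ.eq_start (t - (A ∩ P).card) (by omega)
      obtain ⟨h5, h6⟩ := hP.eq_start (t + 1 - (A ∩ Q).card) (by omega)
      obtain ⟨h7, h8⟩ := hQ.eq_start (t + 1 - (A ∩ P).card) (by omega)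
      simp only [h1, h2, h3, h4, h5, h6, h7, h8]
      exact .refl)
    (by
      rintro t ht ⟨i, j⟩ ⟨h1, h2⟩
      simp only at h1 h2
      obtain ⟨i', j', h3, h4, h5⟩ := Schedule.exists_stable hc hd hPQ hsP hsQ hiP hiQ hP hQ t
        (i + j) i j le_rfl (by omega) (by omega)
      exact ⟨(i', j'), ⟨h3, h4⟩, h5⟩)
  refine ⟨fun t => C (g t).1 ∪ E (g t).2, fun t => D (g t).1 ∪ F (g t).2, ?_, hgr, ?_⟩
  · intro t ht
    rw [hg0 t (by omega)]
    obtain ⟨h1, h2⟩ := hP.eq_start (t - (A ∩ Q).card) (by omega)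
    obtain ⟨h3, h4⟩ := hQ.eq_start (t - (A ∩ P).card) (by omega)
    simp only [h1, h2, h3, h4, hsplit, Finset.union_empty, and_self]
  · intro t ht X hX
    obtain ⟨h1, h2⟩ := hg t
    have h3 := hP.card_le hc (g t).1
    have h4 := hQ.card_le hc (g t).2
    obtain ⟨hXP, hXQ⟩ := tarReachOn_inter_of_union hd
      (m := (C (g t).1).card) (n := (E (g t).2).card)
      (fun Y hY => hP.card_le_of_tarReachOn hc (by omega) (h1 ▸ hY))
      (fun Y hY => hQ.card_le_of_tarReachOn hc (by omega) (h2 ▸ hY)) hX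
    have hXs : X ⊆ P ∪ Q := by
      rcases Relation.ReflTransGen.cases_tail hX with rfl | ⟨_, _, h⟩
      exacts [hAPQ, h.2.1]
    have hXsplit : X ∩ P ∪ X ∩ Q = X := by
      rw [← Finset.inter_union_distrib_left, Finset.inter_eq_left.2 hXs]
    have hCE : Disjoint (C (g t).1) (E (g t).2) :=
      hd.mono (hP.state hsP hiP _).subset (hQ.state hsQ hiQ _).subset
    rw [← hXsplit, Finset.sum_union (hd.mono Finset.inter_subset_right Finset.inter_subset_right),
      Finset.sum_union hCE]
    rw [← h1] at hXP
    rw [← h2] at hXQ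
    exact add_le_add (hP.max _ (by omega) _ hXP) (hQ.max _ (by omega) _ hXQ)

end Union

section Join

variable {G : SimpleGraph V} {c : V → ℕ} {P Q A : Finset V} {C D : ℕ → Finset V}

theorem IsIndep.subset_left_or_right (hPQ : ∀ u ∈ P, ∀ v ∈ Q, G.Adj u v) (hAPQ : A ⊆ P ∪ Q)
    (hA : IsIndep G A) : A ⊆ P ∨ A ⊆ Q := by
  by_contra! h
  obtain ⟨⟨a, ha, haP⟩, b, hb, hbQ⟩ := h.imp Finset.not_subset.1 Finset.not_subset.1
  have haQ := (Finset.mem_union.1 (hAPQ ha)).resolve_left haP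
  have hbP := (Finset.mem_union.1 (hAPQ hb)).resolve_right hbQ
  exact hA b hb a ha (hPQ b hbP a haQ)

/-- With a positive threshold, tokens cannot move to the other side of a join. -/
theorem tarReachOn_of_join (hd : Disjoint P Q) (hPQ : ∀ u ∈ P, ∀ v ∈ Q, G.Adj u v) (hAP : A ⊆ P)
    {t : ℕ} (ht : 0 < t) {X : Finset V} (hX : TarReachOn G (P ∪ Q) t A X) :
    X ⊆ P ∧ TarReachOn G P t A X := by
  induction hX with
  | refl => exact ⟨hAP, .refl⟩
  | @tail X Y hX h ih =>
    obtain ⟨hXP, ih⟩ := ih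
    obtain ⟨hXS, hYS, h⟩ := h
    have hYP : Y ⊆ P := by
      refine (h.2.1.subset_left_or_right hPQ hYS).resolve_right fun hYQ => ?_
      obtain ⟨-, -, h1, h2, v, rfl | rfl⟩ := h
      · obtain ⟨x, hx⟩ := Finset.card_pos.1 (ht.trans_le h1)
        exact Finset.disjoint_left.1 hd (hXP hx) (hYQ (Finset.mem_insert_of_mem hx))
      · obtain ⟨x, hx⟩ := Finset.card_pos.1 (ht.trans_le h2)
        exact Finset.disjoint_left.1 hd (hXP (Finset.mem_insert_of_mem hx)) (hYQ hx)
    exact ⟨hYP, ih.tail ⟨hXP, hYP, h⟩⟩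

theorem exists_schedule_join (hd : Disjoint P Q)
    (hPQ : ∀ u ∈ P, ∀ v ∈ Q, G.Adj u v) (hAP : A ⊆ P) (hA : IsIndep G A)
    (hP : Schedule G c P A C D) : ∃ C' D', Schedule G c (P ∪ Q) A C' D' := by
  classical
  obtain ⟨M, hM, hMmax⟩ := Finset.exists_max_image ((P ∪ Q).powerset.filter (IsIndep G ·))
    (fun X => ∑ v ∈ X, c v)
    ⟨∅, by simp only [Finset.mem_filter, Finset.mem_powerset]; exact ⟨by simp, by simp [IsIndep]⟩⟩
  simp only [Finset.mem_filter, Finset.mem_powerset] at hM hMmax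
  have hbest : ∀ X, TarReachOn G (P ∪ Q) 0 A X → ∑ v ∈ X, c v ≤ ∑ v ∈ M, c v := by
    intro X hX
    refine hMmax X ?_
    rcases Relation.ReflTransGen.cases_tail hX with rfl | ⟨_, _, h⟩
    exacts [⟨hAP.trans Finset.subset_union_left, hA⟩, ⟨h.2.1, h.2.2.2.1⟩]
  have hmax : ∀ t, 0 < t → t ≤ A.card → ∀ X, TarReachOn G (P ∪ Q) t A X →
      ∑ v ∈ X, c v ≤ ∑ v ∈ C t, c v :=
    fun t ht htA X hX => hP.max t htA X (tarReachOn_of_join hd hPQ hAP ht hX).2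
  rcases hM.2.subset_left_or_right hPQ hM.1 with hMP | hMQ
  · refine ⟨C, D, hP.eq_start, fun t => (hP.reach t).mono Finset.subset_union_left, ?_⟩
    intro t ht X hX
    rcases t.eq_zero_or_pos with rfl | htpos
    · refine (hbest X hX).trans (hP.max 0 ht M ?_)
      have h1 : OnceReach G P 0 (A, ∅) (∅, ∅ ∪ A) := .clear A ∅
      have h2 : OnceReach G P 0 (∅, ∅) (∅ ∪ M, ∅) := .add M hMP (by simp) (by simpa using hM.2)
      have h3 := (OnceReach.tarReachOn ⟨hAP, by simp, by simp, hA⟩ (Nat.zero_le _) h1).1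
      have h4 := (OnceReach.tarReachOn ⟨by simp, by simp, by simp, by simp [IsIndep]⟩
        (Nat.zero_le _) h2).1
      rw [Finset.empty_union] at h4
      exact h3.trans h4
    · exact hmax t htpos ht X hX
  · refine ⟨Function.update C 0 M, Function.update D 0 (D 1 ∪ C 1), ?_, ?_, ?_⟩
    · intro t ht
      rw [Function.update_of_ne (by omega), Function.update_of_ne (by omega)]
      exact hP.eq_start t ht
    · rintro (_ | t)
      · have hs := hP.state hAP hA 1
        have h2 : OnceReach G (P ∪ Q) 0 (∅, D 1 ∪ C 1) (∅ ∪ M, D 1 ∪ C 1) :=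
          .add M hM.1 (hd.symm.mono hMQ (Finset.union_subset hs.discarded_subset hs.subset))
            (by simpa using hM.2)
        rw [Finset.empty_union] at h2
        simpa using (OnceReach.clear (C 1) (D 1)).trans h2
      · simpa using (hP.reach (t + 1)).mono Finset.subset_union_left
    · intro t ht X hX
      rcases t.eq_zero_or_pos with rfl | htpos
      · simpa using hbest X hX
      · rw [Function.update_of_ne (by omega)]
        exact hmax t htpos ht X hX

end Join

theorem Cograph.exists_schedule {G : SimpleGraph V} (hG : Cograph G) {c : V → ℕ}
    (hc : CardMono c) (S A : Finset V) (hAS : A ⊆ S) (hA : IsIndep G A) :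
    ∃ C D, Schedule G c S A C D := by
  induction S using Finset.strongInduction generalizing A with
  | H S ih =>
    by_cases hS : 1 < S.card
    · obtain ⟨P, Q, rfl, hd, hP, hQ, h⟩ := hG.splits S hS
      have hPs : P ⊂ P ∪ Q := Finset.ssubset_iff_subset_ne.2 ⟨Finset.subset_union_left, fun h =>
        hQ.ne_empty (Finset.disjoint_self_iff_empty Q |>.1
          (hd.mono_left (h ▸ Finset.subset_union_right)))⟩
      have hQs : Q ⊂ P ∪ Q := Finset.ssubset_iff_subset_ne.2 ⟨Finset.subset_union_right, fun h =>
        hP.ne_empty (Finset.disjoint_self_iff_empty P |>.1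
          (hd.mono_right (h ▸ Finset.subset_union_left)))⟩
      rcases h with h | h
      · obtain ⟨C, D, h1⟩ := ih P hPs (A ∩ P) Finset.inter_subset_right
          (hA.subset Finset.inter_subset_left)
        obtain ⟨E, F, h2⟩ := ih Q hQs (A ∩ Q) Finset.inter_subset_right
          (hA.subset Finset.inter_subset_left)
        exact exists_schedule_union hc hd h hAS hA h1 h2
      · rcases hA.subset_left_or_right h hAS with hAP | hAQ
        · obtain ⟨C, D, h1⟩ := ih P hPs A hAP hA
          exact exists_schedule_join hd h hAP hA h1
        · obtain ⟨C, D, h1⟩ := ih Q hQs A hAQ hA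
          rw [Finset.union_comm]
          exact exists_schedule_join hd.symm (fun u hu v hv => (h v hv u hu).symm) hAQ hA h1
    · refine exists_schedule_of_isIndep (fun u hu v hv => ?_) hAS
      rw [Finset.card_le_one.1 (not_lt.1 hS) u hu v hv]
      exact G.loopless.irrefl v

end Schedule

/-- There are weights, distinct on distinct sets, for which larger sets are heavier. -/
theorem exists_cardMono_injective (V : Type*) [Fintype V] :
    ∃ c : V → ℕ, CardMono c ∧ Function.Injective fun X : Finset V => ∑ v ∈ X, c v := by
  classical
  let e : V ↪ ℕ := (Fintype.equivFin V).toEmbedding.trans Fin.valEmbedding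
  let N := Fintype.card V
  have hlt : ∀ X : Finset V, ∑ v ∈ X, 2 ^ e v < 2 ^ N := by
    intro X
    have h := Finset.sum_map X e (fun i => 2 ^ i)
    rw [← h]
    refine Nat.geomSum_lt le_rfl fun i hi => ?_
    obtain ⟨v, -, rfl⟩ := Finset.mem_map.1 hi
    exact (Fintype.equivFin V v).isLt
  have hsum : ∀ X : Finset V, ∑ v ∈ X, (2 ^ N + 2 ^ e v) = X.card * 2 ^ N + ∑ v ∈ X, 2 ^ e v := by
    intro X
    simp [Finset.sum_add_distrib]
  have hmono : CardMono fun v : V => 2 ^ N + 2 ^ e v := by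
    intro X Y h
    rw [hsum, hsum]
    have h1 := hlt X
    have h2 : (X.card + 1) * 2 ^ N ≤ Y.card * 2 ^ N := Nat.mul_le_mul_right _ h
    rw [add_mul, one_mul] at h2
    omega
  refine ⟨_, hmono, fun X Y h => ?_⟩
  have hcard : X.card = Y.card := by
    rcases lt_trichotomy X.card Y.card with h' | h' | h'
    exacts [absurd h (hmono _ _ h').ne, h', absurd h (hmono _ _ h').ne']
  simp only [hsum, hcard, Nat.add_left_cancel_iff] at h
  rw [← Finset.sum_map X e (fun i => 2 ^ i), ← Finset.sum_map Y e (fun i => 2 ^ i)] at h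
  exact Finset.map_injective e (Finset.equivBitIndices.symm.injective h)

section TokenJumping

variable [DecidableEq V] {G : SimpleGraph V}

/-- One token jump between independent sets of the same size. -/
def TJStep (G : SimpleGraph V) (I J : Finset V) : Prop :=
  IsIndep G I ∧ IsIndep G J ∧ J.card = I.card ∧ ∃ u v : V, u ∈ I ∧ J = insert v (I.erase u)

theorem TJStep.symm {I J : Finset V} (h : TJStep G I J) : TJStep G J I := by
  obtain ⟨hI, hJ, hc, u, v, hu, rfl⟩ := h
  refine ⟨hJ, hI, hc.symm, v, u, Finset.mem_insert_self _ _, ?_⟩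
  have hv : v ∉ I.erase u := by
    intro hv
    rw [Finset.insert_eq_of_mem hv, Finset.card_erase_of_mem hu] at hc
    have := Finset.card_pos.2 ⟨u, hu⟩
    omega
  rw [Finset.erase_insert hv, Finset.insert_erase hu]

/-- `J` is reached from `I` by at most `n` token jumps. -/
inductive TJWithin (G : SimpleGraph V) (I : Finset V) : ℕ → Finset V → Prop
  | refl (n : ℕ) : TJWithin G I n I
  | tail {n : ℕ} {J K : Finset V} : TJWithin G I n J → TJStep G J K → TJWithin G I (n + 1) K

namespace TJWithin

variable {I J K : Finset V} {m n : ℕ}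

theorem mono (h : TJWithin G I m J) (hmn : m ≤ n) : TJWithin G I n J := by
  induction h generalizing n with
  | refl => exact .refl n
  | tail _ hs ih =>
    obtain ⟨n, rfl⟩ : ∃ k, n = k + 1 := ⟨n - 1, by omega⟩
    exact (ih (by omega)).tail hs

theorem trans (h : TJWithin G I m J) (h' : TJWithin G J n K) : TJWithin G I (m + n) K := by
  induction h' with
  | refl => exact h.mono (by omega)
  | tail _ hs ih => exact ih.tail hs

theorem symm (h : TJWithin G I m J) : TJWithin G J m I := by
  induction h with
  | refl n => exact .refl n
  | @tail n J K _ hs ih => exact (((TJWithin.refl 0).tail hs.symm).trans ih).mono (by omega)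

theorem exists_isTJSeq (hI : IsIndep G I) (h : TJWithin G I m J) :
    ∃ n ≤ m, ∃ f : ℕ → Finset V, IsTJSeq G n f ∧ f 0 = I ∧ f n = J := by
  induction h with
  | refl n => exact ⟨0, by omega, fun _ => I, ⟨fun _ _ => hI, by simp, by simp⟩, rfl, rfl⟩
  | @tail m J K _ hs ih =>
    obtain ⟨n, hn, f, ⟨h1, h2, h3⟩, h0, hJ⟩ := ih
    refine ⟨n + 1, by omega, Function.update f (n + 1) K, ⟨?_, ?_, ?_⟩, by simpa using h0, by simp⟩
    · intro i hi
      rcases hi.eq_or_lt with rfl | hi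
      · simpa using hs.2.1
      · rw [Function.update_of_ne (by omega)]; exact h1 i (by omega)
    · intro i hi
      rw [Function.update_of_ne (by omega : (0 : ℕ) ≠ n + 1)]
      rcases hi.eq_or_lt with rfl | hi
      · rw [Function.update_self, hs.2.2.1, ← hJ, h2 n le_rfl]
      · rw [Function.update_of_ne (by omega)]; exact h2 i (by omega)
    · intro i hi
      rw [Function.update_of_ne (by omega : i ≠ n + 1)]
      rcases (Nat.lt_succ_iff.1 hi).eq_or_lt with rfl | hi
      · rw [Function.update_self, hJ]; exact hs.2.2.2
      · rw [Function.update_of_ne (by omega)]; exact h3 i hi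

end TJWithin

/-- Replacing one element by another inside an independent set of the same size is a jump. -/
theorem TJStep.exchange {Z : Finset V} {u v : V} (hZ : IsIndep G Z)
    (hZ' : IsIndep G (insert v (Z.erase u))) (hu : u ∈ Z) (hv : v ∉ Z) :
    TJStep G Z (insert v (Z.erase u)) := by
  refine ⟨hZ, hZ', ?_, u, v, hu, rfl⟩
  rw [Finset.card_insert_of_notMem fun h => hv (Finset.mem_of_mem_erase h),
    Finset.card_erase_add_one hu]

/-- Subsets of the same size of an independent set are joined by direct jumps. -/
theorem TJWithin.of_subset {C Y Z : Finset V} (hC : IsIndep G C) (hY : Y ⊆ C) (hZ : Z ⊆ C)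
    (hc : Y.card = Z.card) : TJWithin G Y (Y \ Z).card Z := by
  generalize hm : (Y \ Z).card = m
  induction m generalizing Y with
  | zero =>
    have : Y ⊆ Z := Finset.sdiff_eq_empty_iff_subset.1 (Finset.card_eq_zero.1 hm)
    rw [Finset.eq_of_subset_of_card_le this hc.ge]
    exact .refl 0
  | succ m ih =>
    obtain ⟨u, hu⟩ := Finset.card_pos.1 (by omega : 0 < (Y \ Z).card)
    obtain ⟨v, hv⟩ := Finset.card_pos.1
      (by rw [Finset.card_sdiff_comm hc.symm]; omega : 0 < (Z \ Y).card)
    rw [Finset.mem_sdiff] at hu hv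
    have hsub : insert v (Y.erase u) ⊆ C :=
      Finset.insert_subset (hZ hv.1) ((Finset.erase_subset _ _).trans hY)
    have hs := TJStep.exchange (hC.subset hY) (hC.subset hsub) hu.1 hv.2
    refine (((TJWithin.refl 0).tail hs).trans (ih hsub (hs.2.2.1.trans hc) ?_)).mono (by omega)
    rw [Finset.insert_sdiff_of_mem _ hv.1, Finset.erase_sdiff_comm,
      Finset.card_erase_of_mem (Finset.mem_sdiff.2 hu), hm, Nat.add_sub_cancel]

/-- A sequence of additions and removals above `k` yields token jumps of `k + 1` tokens, at most
one for every removal. -/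
theorem OnceReach.exists_tjWithin {S A : Finset V} {k : ℕ} {q : Finset V × Finset V}
    (hAS : A ⊆ S) (hA : IsIndep G A) (hcard : A.card = k + 1) (h : OnceReach G S k (A, ∅) q) :
    ∃ Z, IsIndep G Z ∧ Z.card = k + 1 ∧
      ((Z ⊆ q.1 ∧ TJWithin G A q.2.card Z) ∨
        (q.1 ⊆ Z ∧ q.1.card = k ∧ ∃ m < q.2.card, TJWithin G A m Z)) := by
  induction h with
  | refl => exact ⟨A, hA, hcard, .inl ⟨subset_rfl, .refl _⟩⟩
  | @tail q r hq h ih =>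
    obtain ⟨Z, hZ, hZc, ih⟩ := ih
    have hsq : OnceState G S q := OnceState.reach ⟨hAS, by simp, by simp, hA⟩ hq
    rcases h with ⟨v, hvS, hv1, hv2, hi, rfl⟩ | ⟨v, hv, hc, rfl⟩
    · rcases ih with ⟨hZq, hm⟩ | ⟨hqZ, hqc, m, hm, hZm⟩
      · exact ⟨Z, hZ, hZc, .inl ⟨hZq.trans (Finset.subset_insert _ _), hm⟩⟩
      · by_cases hvZ : v ∈ Z
        · have : insert v q.1 = Z := Finset.eq_of_subset_of_card_le
            (Finset.insert_subset hvZ hqZ) (by rw [Finset.card_insert_of_notMem hv1]; omega)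
          exact ⟨Z, hZ, hZc, .inl ⟨this.ge, hZm.mono hm.le⟩⟩
        · obtain ⟨u, hu⟩ := Finset.card_pos.1
            (by rw [Finset.card_sdiff_of_subset hqZ]; omega : 0 < (Z \ q.1).card)
          rw [Finset.mem_sdiff] at hu
          have he : q.1 = Z.erase u := Finset.eq_of_subset_of_card_le
            (fun x hx => Finset.mem_erase.2 ⟨fun h => hu.2 (h ▸ hx), hqZ hx⟩)
            (by rw [Finset.card_erase_of_mem hu.1]; omega)
          rw [he] at hi
          have hs := TJStep.exchange hZ hi hu.1 hvZ
          exact ⟨insert v (Z.erase u), hi, hs.2.2.1.trans hZc,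
            .inl ⟨by simp only [he]; exact subset_rfl, (hZm.tail hs).mono hm⟩⟩
    · have hvD : v ∉ q.2 := Finset.disjoint_left.1 hsq.disjoint hv
      have hec := Finset.card_erase_add_one hv
      simp only [Finset.card_insert_of_notMem hvD]
      rcases ih with ⟨hZq, hm⟩ | ⟨hqZ, hqc, m, hm, hZm⟩
      · by_cases hvZ : v ∈ Z
        · by_cases hqk : (q.1.erase v).card = k
          · have : Z = q.1 := Finset.eq_of_subset_of_card_le hZq (by omega)
            exact ⟨Z, hZ, hZc, .inr ⟨this ▸ Finset.erase_subset _ _, hqk, _, Nat.lt_succ_self _, hm⟩⟩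
          · obtain ⟨w, hw⟩ := Finset.card_pos.1
              (by rw [Finset.card_sdiff_of_subset hZq]; omega : 0 < (q.1 \ Z).card)
            rw [Finset.mem_sdiff] at hw
            have hsub : insert w (Z.erase v) ⊆ q.1.erase v := by
              refine Finset.insert_subset (Finset.mem_erase.2 ⟨?_, hw.1⟩)
                (Finset.erase_subset_erase _ hZq)
              rintro rfl
              exact hw.2 hvZ
            have hind := hsq.indep.subset (hsub.trans (Finset.erase_subset _ _))
            have hs := TJStep.exchange hZ hind hvZ hw.2
            exact ⟨_, hind, hs.2.2.1.trans hZc, .inl ⟨hsub, hm.tail hs⟩⟩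
        · refine ⟨Z, hZ, hZc, .inl ⟨fun x hx => Finset.mem_erase.2 ⟨?_, hZq hx⟩,
            hm.mono (Nat.le_succ _)⟩⟩
          rintro rfl
          exact hvZ hx
      · omega

theorem IsTJSeq.tarReachOn [Fintype V] {n k : ℕ} {f : ℕ → Finset V} (h : IsTJSeq G n f)
    (hk : (f 0).card = k + 1) : TarReachOn G Finset.univ k (f 0) (f n) := by
  obtain ⟨h1, h2, h3⟩ := h
  have key : ∀ i ≤ n, TarReachOn G Finset.univ k (f 0) (f i) := by
    intro i
    induction i with
    | zero => exact fun _ => .refl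
    | succ i ih =>
      intro hi
      obtain ⟨u, v, hu, he⟩ := h3 i hi
      have hc := h2 i (by omega)
      have hc' := h2 (i + 1) hi
      have hec := Finset.card_erase_add_one hu
      have hind := (h1 i (by omega)).subset (Finset.erase_subset u _)
      refine ((ih (by omega)).tail (b := f i) (c := (f i).erase u) ?_).tail ?_
      · exact ⟨by simp, by simp, h1 i (by omega), hind, by omega, by omega, u,
          .inr (Finset.insert_erase hu).symm⟩
      · exact ⟨by simp, by simp, hind, h1 (i + 1) hi, by omega, by omega, v, .inl he⟩
  exact key n le_rfl

end TokenJumping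

/-- Lowering the threshold from the start to `t` is a single pass. -/
theorem Schedule.onceReach [DecidableEq V] {G : SimpleGraph V} {c : V → ℕ} {S A : Finset V}
    {C D : ℕ → Finset V} (h : Schedule G c S A C D) (t : ℕ) :
    OnceReach G S t (A, ∅) (C t, D t) := by
  have key : ∀ d s, A.card < s + d → OnceReach G S s (A, ∅) (C s, D s) := by
    intro d
    induction d with
    | zero =>
      intro s hs
      obtain ⟨h1, h2⟩ := h.eq_start s hs
      rw [h1, h2]
    | succ d ih =>
      intro s hs
      refine Relation.ReflTransGen.trans ?_ (h.reach s)
      exact Relation.ReflTransGen.mono (fun _ _ h =>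
        h.imp id fun ⟨v, hv, ht, hq⟩ => ⟨v, hv, by omega, hq⟩) _ _ (ih (s + 1) (by omega))
  exact key (A.card + 1) t (by omega)

/-- In a cograph on `n` vertices, any two independent sets of size `k` in the
same component of `TJ_k(G)` are joined by a TJ-sequence of length at most
`2n - k`. -/
theorem cograph_tj_diameter [Fintype V] [DecidableEq V] (G : SimpleGraph V)
    (hG : Cograph G) (k : ℕ) (A B : Finset V)
    (hA : IsIndep G A) (hB : IsIndep G B)
    (hcA : A.card = k) (hcB : B.card = k)
    (h : ∃ n : ℕ, ∃ f : ℕ → Finset V, IsTJSeq G n f ∧ f 0 = A ∧ f n = B) :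
    ∃ n ≤ 2 * Fintype.card V - k, ∃ f : ℕ → Finset V,
      IsTJSeq G n f ∧ f 0 = A ∧ f n = B := by
  refine TJWithin.exists_isTJSeq hA ?_
  rcases k with _ | k
  · rw [Finset.card_eq_zero.1 hcA, Finset.card_eq_zero.1 hcB]
    exact .refl _
  obtain ⟨n, f, hf, rfl, rfl⟩ := h
  obtain ⟨c, hc, hinj⟩ := exists_cardMono_injective V
  have hAB := hf.tarReachOn hcA
  obtain ⟨C, D, hCD⟩ := hG.exists_schedule hc Finset.univ (f 0) (Finset.subset_univ _) hA
  obtain ⟨E, F, hEF⟩ := hG.exists_schedule hc Finset.univ (f n) (Finset.subset_univ _) hB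
  have hCE : C k = E k := by
    refine hinj (le_antisymm ?_ ?_)
    · exact hEF.max k (by omega) _
        (hAB.symm.trans (hCD.tarReachOn (Finset.subset_univ _) hA (by omega)))
    · exact hCD.max k (by omega) _
        (hAB.trans (hEF.tarReachOn (Finset.subset_univ _) hB (by omega)))
  have hkC := hCD.card_le hc k
  have hCs := hCD.state (Finset.subset_univ _) hA k
  have hEs := hEF.state (Finset.subset_univ _) hB k
  have hDc : (C k).card + (D k).card ≤ Fintype.card V := by
    rw [← Finset.card_union_of_disjoint hCs.disjoint]; exact Finset.card_le_univ _
  have hFc : (E k).card + (F k).card ≤ Fintype.card V := by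
    rw [← Finset.card_union_of_disjoint hEs.disjoint]; exact Finset.card_le_univ _
  obtain ⟨Y, -, hYc, ⟨hYC, hY⟩ | ⟨-, h', -⟩⟩ :=
    (hCD.onceReach k).exists_tjWithin (Finset.subset_univ _) hA hcA
  swap
  · simp only at h'; omega
  obtain ⟨Z, -, hZc, ⟨hZE, hZ⟩ | ⟨-, h', -⟩⟩ :=
    (hEF.onceReach k).exists_tjWithin (Finset.subset_univ _) hB hcB
  swap
  · simp only [← hCE] at h'; omega
  have hYZ := TJWithin.of_subset hCs.indep hYC (hCE ▸ hZE) (hYc.trans hZc.symm)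
  have hle : (Y \ Z).card ≤ k + 1 := hYc ▸ Finset.card_le_card Finset.sdiff_subset
  rw [← hCE] at hFc
  exact ((hY.trans hYZ).trans hZ.symm).mono (by simp only; omega)
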